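/- Let A be a C*-algebra, E ⊆ A an exact closed subspace, H a Hilbert space, v : E → H a linear map, and C > 0 a constant. Assume that for every n and every matrix (x_{ij}) ∈ M_n(E), ((1/n)·∑_{i,j=1}^n ‖v(x_{ij})‖²)^{1/2} ≤ C·‖(x_{ij})‖_{M_n(E)}. Then v is (2,RC)-summing and π_{2,RC}(v) ≤ 2C·d_SK(E). -/

import Mathlib

open scoped ComplexOrder

noncomputable section

/-- The norm of an element of a unital complex `*`-algebra computed spectrally: the square
root of the spectral radius of `star a * a`.  On a unital C*-algebra this coincides with
the norm, and on the matrix algebra `Mₙ(A)` over a unital C*-algebra `A` it is the unique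
C*-norm of `Mₙ(A)`. -/
def cstarNorm {A : Type*} [Ring A] [Algebra ℂ A] [Star A] (a : A) : ℝ :=
  Real.sqrt (spectralRadius ℂ (star a * a)).toReal

/-- The norm of a matrix with entries in a subspace `E` of `A` (the subspace being given by
the embedding `ι : E →ₗ A`), i.e. the norm of `Mₙ(E)` inherited from the C*-algebra
`Mₙ(A)`. -/
def matNorm {A : Type*} [Ring A] [Algebra ℂ A] [StarRing A]
    {E : Type*} [AddCommGroup E] [Module ℂ E] (ι : E →ₗ[ℂ] A)
    {n : ℕ} (x : Matrix (Fin n) (Fin n) E) : ℝ :=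
  cstarNorm (x.map fun e => ι e)

/-- `RCBound ι v C` : the map `v`, defined on the subspace `E ⊆ A` given by the embedding
`ι`, is `(2,RC)`-summing with constant `C`, i.e. for every finite family `(x₁,…,xₙ)` in `E`
one has `∑ ‖v xᵢ‖² ≤ C² · RC((xᵢ))`, where
`RC((xᵢ)) = max(‖∑ xᵢ xᵢ*‖, ‖∑ xᵢ* xᵢ‖)`.  "`v` is `(2,RC)`-summing with
`π_{2,RC}(v) ≤ C`" is expressed by `RCBound ι v C`. -/
def RCBound {A : Type*} [NormedRing A] [StarRing A] [NormedAlgebra ℂ A]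
    {E : Type*} [AddCommGroup E] [Module ℂ E] (ι : E →ₗ[ℂ] A)
    {Y : Type*} [NormedAddCommGroup Y] [NormedSpace ℂ Y] (v : E →ₗ[ℂ] Y) (C : ℝ) : Prop :=
  ∀ (n : ℕ) (x : Fin n → E),
    ∑ i, ‖v (x i)‖ ^ 2 ≤
      C ^ 2 * max ‖∑ i, ι (x i) * star (ι (x i))‖ ‖∑ i, star (ι (x i)) * ι (x i)‖

/-- The set of norms of amplifications defining the completely bounded norm of a linear
map `v : E → F` between subspaces of `*`-algebras (given by embeddings `ι`, `κ`): the
norms `‖(v(x_{ij}))‖_{Mₙ(B)}` over matrices `x ∈ Mₙ(E)` of norm at most 1. -/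
def cbNormSet {A B : Type*} [Ring A] [Algebra ℂ A] [StarRing A]
    [Ring B] [Algebra ℂ B] [StarRing B]
    {E F : Type*} [AddCommGroup E] [Module ℂ E] [AddCommGroup F] [Module ℂ F]
    (ι : E →ₗ[ℂ] A) (κ : F →ₗ[ℂ] B) (v : E →ₗ[ℂ] F) : Set ℝ :=
  {r | ∃ (n : ℕ) (x : Matrix (Fin n) (Fin n) E),
    matNorm ι x ≤ 1 ∧ r = matNorm κ (x.map fun e => v e)}

/-- The completely bounded norm `‖v‖_cb` of a linear map between subspaces of
`*`-algebras. -/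
def cbNorm {A B : Type*} [Ring A] [Algebra ℂ A] [StarRing A]
    [Ring B] [Algebra ℂ B] [StarRing B]
    {E F : Type*} [AddCommGroup E] [Module ℂ E] [AddCommGroup F] [Module ℂ F]
    (ι : E →ₗ[ℂ] A) (κ : F →ₗ[ℂ] B) (v : E →ₗ[ℂ] F) : ℝ :=
  sSup (cbNormSet ι κ v)

/-- `d_SK(G)` for a (finite-dimensional) subspace `G` of a C*-algebra: the infimum of
`‖v‖_cb ‖v⁻¹‖_cb` over all linear isomorphisms `v` from `G` onto a subspace of a matrix
algebra `M_N(ℂ)`. -/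
def dSKfin {A : Type*} [NormedRing A] [StarRing A] [NormedAlgebra ℂ A]
    (G : Submodule ℂ A) : ℝ :=
  sInf {c | ∃ (N : ℕ) (Fm : Submodule ℂ (Matrix (Fin N) (Fin N) ℂ)) (v : ↥G ≃ₗ[ℂ] ↥Fm),
    c = cbNorm G.subtype Fm.subtype v.toLinearMap *
        cbNorm Fm.subtype G.subtype v.symm.toLinearMap}

/-- The set of values `d_SK(G)` over finite-dimensional subspaces `G ⊆ E`. -/
def dSKSet {A : Type*} [NormedRing A] [StarRing A] [NormedAlgebra ℂ A]
    (E : Submodule ℂ A) : Set ℝ :=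
  {r | ∃ G : Submodule ℂ A, G ≤ E ∧ FiniteDimensional ℂ ↥G ∧ r = dSKfin G}

/-- `d_SK(E) = sup { d_SK(G) : G ⊆ E finite-dimensional }`. -/
def dSK {A : Type*} [NormedRing A] [StarRing A] [NormedAlgebra ℂ A]
    (E : Submodule ℂ A) : ℝ := sSup (dSKSet E)

/-- A subspace `E` of a C*-algebra is exact if `d_SK(E) < ∞`, i.e. the values `d_SK(G)`
over finite-dimensional `G ⊆ E` are bounded above. -/
def IsExactSubspace {A : Type*} [NormedRing A] [StarRing A] [NormedAlgebra ℂ A]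
    (E : Submodule ℂ A) : Prop := BddAbove (dSKSet E)


/-! ### The spectral norm -/

section CStarNorm

lemma cstarNorm_eq_norm {B : Type*} [CStarAlgebra B] (b : B) : cstarNorm b = ‖b‖ := by
  rw [cstarNorm, CStarAlgebra.toReal_spectralRadius_star_mul_self_eq_norm_sq,
    Real.sqrt_sq (norm_nonneg b)]

lemma cstarNorm_map {B B' : Type*} [Ring B] [Algebra ℂ B] [Star B] [Ring B'] [Algebra ℂ B']
    [Star B'] (f : B ≃ₐ[ℂ] B') (hf : ∀ b, f (star b) = star (f b)) (b : B) :
    cstarNorm (f b) = cstarNorm b := by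
  rw [cstarNorm, cstarNorm, ← hf, ← map_mul, spectralRadius, spectralRadius, AlgEquiv.spectrum_eq]

lemma norm_mul_pow_le_of_projection {B : Type*} [CStarAlgebra B] (x p : B) (hp : star p = p)
    (hpp : p * p = p) (r : ℕ) : (‖x * p‖ ^ 2) ^ 2 ^ r ≤ ‖(star x * x) ^ 2 ^ r * p‖ := by
  have hp1 : ‖p‖ ≤ 1 := by
    have h : ‖p‖ * ‖p‖ = ‖p‖ := by rw [← CStarRing.norm_star_mul_self (x := p), hp, hpp]
    nlinarith [norm_nonneg p]
  have key : ∀ z : B, ‖z * p‖ ^ 2 ≤ ‖star z * z * p‖ := fun z => by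
    rw [sq, ← CStarRing.norm_star_mul_self, star_mul, hp, mul_assoc, ← mul_assoc (star z)]
    exact (norm_mul_le _ _).trans (mul_le_of_le_one_left (norm_nonneg _) hp1)
  induction r with
  | zero => simpa using key x
  | succ r ih =>
    rw [pow_succ 2 r, pow_mul, pow_mul]
    refine (pow_le_pow_left₀ (by positivity) ih 2).trans ((key _).trans_eq ?_)
    rw [star_pow, star_mul, star_star, sq]

end CStarNorm

/-! ### Free actions of free groups on finite sets -/

section FreeGroup

variable {α : Type*} [DecidableEq α]

/-- Left multiplication by a generator, as a partial bijection of a ball of the free group,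
extended to a permutation of that ball. -/
def FreeGroup.ballPerm [Fintype α] (L : ℕ) [Finite {w : FreeGroup α // w.norm ≤ L}] (a : α) :
    Equiv.Perm {w : FreeGroup α // w.norm ≤ L} :=
  Equiv.extendSubtype
    (p := fun w : {w : FreeGroup α // w.norm ≤ L} => (FreeGroup.of a * w.1).norm ≤ L)
    (q := fun w : {w : FreeGroup α // w.norm ≤ L} => ((FreeGroup.of a)⁻¹ * w.1).norm ≤ L)
    { toFun := fun w => ⟨⟨FreeGroup.of a * w.1.1, w.2⟩, by simpa using w.1.2⟩
      invFun := fun w => ⟨⟨(FreeGroup.of a)⁻¹ * w.1.1, w.2⟩, by simpa using w.1.2⟩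
      left_inv := fun w => by ext; simp
      right_inv := fun w => by ext; simp }

lemma FreeGroup.coe_ballPerm_apply [Fintype α] (L : ℕ)
    [Finite {w : FreeGroup α // w.norm ≤ L}] (a : α) (w : {w : FreeGroup α // w.norm ≤ L})
    (hw : (FreeGroup.of a * w.1).norm ≤ L) :
    (FreeGroup.ballPerm L a w).1 = FreeGroup.of a * w.1 := by
  have := Fintype.ofFinite {w : FreeGroup α // w.norm ≤ L}
  unfold FreeGroup.ballPerm
  rw [Equiv.extendSubtype_apply_of_mem]
  · rfl
  · exact hw

lemma FreeGroup.finite_ball [Fintype α] (L : ℕ) : Finite {w : FreeGroup α // w.norm ≤ L} := by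
  have : Finite {l : List (α × Bool) // l.length ≤ L} := List.finite_length_le (α × Bool) L
  refine Finite.of_injective
    (fun w : {w : FreeGroup α // w.norm ≤ L} =>
      (⟨w.1.toWord, w.2⟩ : {l : List (α × Bool) // l.length ≤ L})) ?_
  intro v w h
  simpa [Subtype.ext_iff, FreeGroup.toWord_inj] using h

lemma FreeGroup.coe_lift_ballPerm_mk [Fintype α] (L : ℕ)
    [Finite {w : FreeGroup α // w.norm ≤ L}] (h1 : (1 : FreeGroup α).norm ≤ L) :
    ∀ (l : List (α × Bool)) (_ : l.length ≤ L),
      (FreeGroup.lift (FreeGroup.ballPerm L) (FreeGroup.mk l) ⟨1, h1⟩).1 = FreeGroup.mk l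
  | [], _ => by
    rw [← FreeGroup.one_eq_mk, _root_.map_one]
    rfl
  | (a, b) :: l, hl => by
    have hl' : l.length ≤ L := (Nat.le_succ _).trans hl
    have ih := FreeGroup.coe_lift_ballPerm_mk L h1 l hl'
    have hcons : FreeGroup.mk ((a, b) :: l) = FreeGroup.mk [(a, b)] * FreeGroup.mk l := by
      simp [FreeGroup.mul_mk]
    have hnorm : (FreeGroup.mk ((a, b) :: l)).norm ≤ L := FreeGroup.norm_mk_le.trans hl
    rw [hcons] at hnorm
    rw [hcons, _root_.map_mul, Equiv.Perm.mul_apply]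
    set w := FreeGroup.lift (FreeGroup.ballPerm L) (FreeGroup.mk l) ⟨1, h1⟩
    cases b with
    | true =>
      have hof : FreeGroup.mk [(a, true)] = FreeGroup.of a := rfl
      rw [hof] at hnorm ⊢
      rw [FreeGroup.lift_apply_of, FreeGroup.coe_ballPerm_apply _ _ _ (by rwa [ih]), ih]
    | false =>
      have hof : FreeGroup.mk [(a, false)] = (FreeGroup.of a)⁻¹ := rfl
      rw [hof] at hnorm ⊢
      rw [_root_.map_inv, FreeGroup.lift_apply_of]
      have h2 : w = FreeGroup.ballPerm L a ⟨(FreeGroup.of a)⁻¹ * FreeGroup.mk l, hnorm⟩ := by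
        refine Subtype.ext ?_
        rw [FreeGroup.coe_ballPerm_apply]
        · simp [ih]
        · simpa using FreeGroup.norm_mk_le.trans hl'
      rw [h2]
      simp

/-- A free group acts on a finite set in such a way that the elements of a given finite set act
in pairwise everywhere different ways. -/
theorem FreeGroup.exists_perm_separating [Fintype α] (S : Finset (FreeGroup α)) :
    ∃ (n : ℕ) (_ : 0 < n) (φ : FreeGroup α →* Equiv.Perm (Fin n)),
      ∀ g ∈ S, ∀ h ∈ S, ∀ i, φ g i = φ h i → g = h := by
  set L := S.sup FreeGroup.norm with hL
  have := FreeGroup.finite_ball (α := α) L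
  have := Fintype.ofFinite {w : FreeGroup α // w.norm ≤ L}
  set ψ := FreeGroup.lift (FreeGroup.ballPerm (α := α) L)
  have h1 : (1 : FreeGroup α).norm ≤ L := by simp
  have hψ : ∀ g ∈ S, (ψ g ⟨1, h1⟩).1 = g := by
    intro g hg
    have h := FreeGroup.coe_lift_ballPerm_mk L h1 g.toWord
      (Finset.le_sup (f := FreeGroup.norm) hg)
    rwa [FreeGroup.mk_toWord] at h
  let Γ := Equiv.Perm {w : FreeGroup α // w.norm ≤ L}
  have e : Γ ≃ Fin (Fintype.card Γ) := Fintype.equivFin _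
  refine ⟨Fintype.card Γ, Fintype.card_pos,
    (e.permCongrHom.toMonoidHom.comp (MulAction.toPermHom Γ Γ)).comp ψ, ?_⟩
  intro g hg h hh i hi
  have h2 : ψ g = ψ h := by simpa [Equiv.permCongrHom] using hi
  rw [← hψ g hg, ← hψ h hh, h2]

end FreeGroup

/-! ### Ping-pong estimates for operator-valued convolution -/

section PingPong

/-- A ping-pong configuration: the translates `s k` together with sets `P k` such that the `P k`
are pairwise disjoint and the sets `{h | s k * h ∉ P k}` are pairwise disjoint. -/
structure PingPong {F κ : Type*} [Group F] (s : κ → F) (P : κ → Set F) : Prop where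
  attracting : ∀ g k l, g ∈ P k → g ∈ P l → k = l
  repelling : ∀ g k l, s k * g ∉ P k → s l * g ∉ P l → k = l

lemma PingPong.inv {F κ : Type*} [Group F] {s : κ → F} {P : κ → Set F} (h : PingPong s P) :
    PingPong (fun k => (s k)⁻¹) (fun k => {g | s k * g ∉ P k}) where
  attracting g k l hk hl := h.repelling g k l hk hl
  repelling g k l hk hl := by
    simp only [Set.mem_ofPred_eq, mul_inv_cancel_left, not_not] at hk hl
    exact h.attracting g k l hk hl

lemma FreeGroup.pingPong (κ : Type*) [DecidableEq κ] :
    PingPong (FreeGroup.of : κ → FreeGroup κ)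
      (fun k => {g | g.toWord.head? = some (k, true)}) where
  attracting g k l hk hl := by
    simp only [Set.mem_ofPred_eq] at hk hl
    rw [hk] at hl
    simpa using hl
  repelling g k l hk hl := by
    have key : ∀ k, (FreeGroup.of k * g).toWord.head? ≠ some (k, true) →
        g.toWord.head? = some (k, false) := by
      intro k hk
      have hw : (FreeGroup.of k * g).toWord = FreeGroup.reduce ((k, true) :: g.toWord) := by
        rw [FreeGroup.toWord_mul, FreeGroup.toWord_of]
        rfl
      rw [hw, FreeGroup.reduce.cons, FreeGroup.reduce_toWord] at hk
      cases hg : g.toWord with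
      | nil => simp [hg] at hk
      | cons p t =>
        obtain ⟨a, b⟩ := p
        rw [hg] at hk
        dsimp only at hk
        by_cases hab : k = a ∧ true = !b
        · obtain ⟨rfl, hb⟩ := hab
          have : b = false := by simpa using hb.symm
          rw [this]
          rfl
        · rw [if_neg hab] at hk
          exact absurd rfl hk
    have h1 := key k hk
    rw [key l hl] at h1
    simpa using h1.symm

variable {F κ W : Type*} [Group F] [Fintype κ] [SeminormedAddCommGroup W]

lemma norm_sum_sq_le_of_unique (p : κ → Prop) [DecidablePred p] (hp : ∀ k l, p k → p l → k = l)
    (a : κ → W) : ‖∑ k, if p k then a k else 0‖ ^ 2 ≤ ∑ k, ‖a k‖ ^ 2 := by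
  by_cases h : ∃ k, p k
  · obtain ⟨k, hk⟩ := h
    rw [Finset.sum_eq_single k (fun l _ hl => if_neg fun h => hl (hp l k h hk))
      (by simp), if_pos hk]
    exact Finset.single_le_sum (f := fun k => ‖a k‖ ^ 2) (fun _ _ => by positivity)
      (Finset.mem_univ k)
  · push Not at h
    simp only [h, if_false, Finset.sum_const_zero, norm_zero, ne_eq, OfNat.ofNat_ne_zero,
      not_false_eq_true, zero_pow]
    exact Finset.sum_nonneg fun _ _ => by positivity

lemma sum_ite_le_of_unique (p : κ → Prop) [DecidablePred p] (hp : ∀ k l, p k → p l → k = l)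
    (t : ENNReal) : (∑ k, if p k then t else 0) ≤ t := by
  by_cases h : ∃ k, p k
  · obtain ⟨k, hk⟩ := h
    rw [Finset.sum_eq_single k (fun l _ hl => if_neg fun h => hl (hp l k h hk))
      (by simp), if_pos hk]
  · push Not at h
    simp [h]

/-- Operator-valued convolution along a ping-pong configuration is bounded by twice the maximum
of the row and column norms of its coefficients. -/
theorem PingPong.tsum_norm_sq_le {s : κ → F} {P : κ → Set F} (hsP : PingPong s P)
    (y : κ → W → W) {D : ℝ} (hD : 0 ≤ D)
    (hcol : ∀ w, ∑ k, ‖y k w‖ ^ 2 ≤ D * ‖w‖ ^ 2)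
    (hrow : ∀ w : κ → W, ‖∑ k, y k (w k)‖ ^ 2 ≤ D * ∑ k, ‖w k‖ ^ 2) (f : F → W) :
    ∑' g, ENNReal.ofReal (‖∑ k, y k (f ((s k)⁻¹ * g))‖ ^ 2) ≤
      ENNReal.ofReal (4 * D) * ∑' g, ENNReal.ofReal (‖f g‖ ^ 2) := by
  classical
  set T := ∑' g, ENNReal.ofReal (‖f g‖ ^ 2) with hT
  have y0 : ∀ k, ‖y k 0‖ = 0 := by
    intro k
    have h := hcol 0
    have h2 := Finset.single_le_sum (f := fun k => ‖y k 0‖ ^ 2) (fun _ _ => by positivity)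
      (Finset.mem_univ k)
    have h3 : ‖y k 0‖ ^ 2 ≤ 0 := by
      refine h2.trans (h.trans ?_)
      simp
    have h4 : ‖y k 0‖ ^ 2 = 0 := le_antisymm h3 (by positivity)
    exact pow_eq_zero_iff (two_ne_zero) |>.1 h4
  have hpt : ∀ g, ENNReal.ofReal (‖∑ k, y k (f ((s k)⁻¹ * g))‖ ^ 2) ≤
      (∑ k, 2 * ENNReal.ofReal (‖y k (f ((s k)⁻¹ * g))‖ ^ 2)) +
      ∑ k, ENNReal.ofReal (2 * D) *
        if g ∉ P k then ENNReal.ofReal (‖f ((s k)⁻¹ * g)‖ ^ 2) else 0 := by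
    intro g
    set a : κ → W := fun k => if g ∈ P k then y k (f ((s k)⁻¹ * g)) else 0
    set b : κ → W := fun k => if g ∈ P k then 0 else y k (f ((s k)⁻¹ * g))
    have hab : ∑ k, y k (f ((s k)⁻¹ * g)) = ∑ k, a k + ∑ k, b k := by
      rw [← Finset.sum_add_distrib]
      refine Finset.sum_congr rfl fun k _ => ?_
      simp only [a, b]
      split_ifs <;> simp
    have ha : ‖∑ k, a k‖ ^ 2 ≤ ∑ k, ‖y k (f ((s k)⁻¹ * g))‖ ^ 2 :=
      norm_sum_sq_le_of_unique (fun k => g ∈ P k) (hsP.attracting g) _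
    have hb : ‖∑ k, b k‖ ^ 2 ≤ D * ∑ k, if g ∉ P k then ‖f ((s k)⁻¹ * g)‖ ^ 2 else 0 := by
      have h1 := hrow (fun k => if g ∈ P k then 0 else f ((s k)⁻¹ * g))
      have h2 : ‖∑ k, b k - ∑ k, y k (if g ∈ P k then 0 else f ((s k)⁻¹ * g))‖ ≤ 0 := by
        rw [← Finset.sum_sub_distrib]
        refine (norm_sum_le _ _).trans (Finset.sum_nonpos fun k _ => ?_)
        simp only [b]
        split_ifs <;> simp [y0]
      have h3 : ‖∑ k, b k‖ ≤ ‖∑ k, y k (if g ∈ P k then 0 else f ((s k)⁻¹ * g))‖ := by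
        have := norm_sub_norm_le (∑ k, b k) (∑ k, y k (if g ∈ P k then 0 else f ((s k)⁻¹ * g)))
        linarith
      refine (pow_le_pow_left₀ (norm_nonneg _) h3 2).trans (h1.trans_eq ?_)
      congr 1
      refine Finset.sum_congr rfl fun k _ => ?_
      split_ifs <;> simp_all
    have hsum : ‖∑ k, y k (f ((s k)⁻¹ * g))‖ ^ 2 ≤ (∑ k, 2 * ‖y k (f ((s k)⁻¹ * g))‖ ^ 2) +
        ∑ k, (2 * D) * if g ∉ P k then ‖f ((s k)⁻¹ * g)‖ ^ 2 else 0 := by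
      rw [hab, ← Finset.mul_sum, ← Finset.mul_sum]
      have h1 := norm_add_le (∑ k, a k) (∑ k, b k)
      nlinarith [sq_nonneg (‖∑ k, a k‖ - ‖∑ k, b k‖), norm_nonneg (∑ k, a k + ∑ k, b k)]
    refine (ENNReal.ofReal_le_ofReal hsum).trans_eq ?_
    rw [ENNReal.ofReal_add (by positivity) (Finset.sum_nonneg fun k _ => by
        split_ifs <;> positivity), ENNReal.ofReal_sum_of_nonneg (fun _ _ => by positivity),
      ENNReal.ofReal_sum_of_nonneg (fun k _ => by split_ifs <;> positivity)]
    congr 1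
    · refine Finset.sum_congr rfl fun k _ => ?_
      rw [ENNReal.ofReal_mul (by norm_num)]
      norm_num
    · refine Finset.sum_congr rfl fun k _ => ?_
      rw [ENNReal.ofReal_mul (by positivity)]
      split_ifs <;> simp
  have h4 : ENNReal.ofReal (4 * D) = 2 * ENNReal.ofReal D + ENNReal.ofReal (2 * D) := by
    rw [show (2 : ENNReal) = ENNReal.ofReal 2 by norm_num, ← ENNReal.ofReal_mul (by norm_num),
      ← ENNReal.ofReal_add (by positivity) (by positivity)]
    congr 1
    ring
  refine (ENNReal.tsum_le_tsum hpt).trans ?_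
  rw [ENNReal.tsum_add, h4, add_mul]
  refine add_le_add ?_ ?_
  · rw [Summable.tsum_finsetSum (fun _ _ => ENNReal.summable)]
    have h5 : ∀ k, ∑' g, 2 * ENNReal.ofReal (‖y k (f ((s k)⁻¹ * g))‖ ^ 2) =
        ∑' g, 2 * ENNReal.ofReal (‖y k (f g)‖ ^ 2) := fun k =>
      (Equiv.mulLeft (s k)⁻¹).tsum_eq (fun g => 2 * ENNReal.ofReal (‖y k (f g)‖ ^ 2))
    simp_rw [h5]
    rw [← Summable.tsum_finsetSum (fun _ _ => ENNReal.summable), hT, mul_assoc,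
      ← ENNReal.tsum_mul_left, ← ENNReal.tsum_mul_left]
    refine ENNReal.tsum_le_tsum fun g => ?_
    rw [← Finset.mul_sum, ← ENNReal.ofReal_sum_of_nonneg (fun _ _ => by positivity),
      ← ENNReal.ofReal_mul hD]
    gcongr
    exact hcol _
  · rw [Summable.tsum_finsetSum (fun _ _ => ENNReal.summable)]
    have h5 : ∀ k, ∑' g, ENNReal.ofReal (2 * D) *
        (if g ∉ P k then ENNReal.ofReal (‖f ((s k)⁻¹ * g)‖ ^ 2) else 0) =
        ∑' g, ENNReal.ofReal (2 * D) *
          if s k * g ∉ P k then ENNReal.ofReal (‖f g‖ ^ 2) else 0 := fun k => by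
      rw [← (Equiv.mulLeft (s k)).tsum_eq]
      simp
    simp_rw [h5]
    rw [← Summable.tsum_finsetSum (fun _ _ => ENNReal.summable), hT, ← ENNReal.tsum_mul_left]
    refine ENNReal.tsum_le_tsum fun g => ?_
    rw [← Finset.mul_sum]
    gcongr
    exact sum_ite_le_of_unique _ (fun k l hk hl => hsP.repelling g k l hk hl) _

end PingPong

/-! ### Row and column bounds -/

section RowColumn

variable {κ W : Type*} [Fintype κ] [NormedAddCommGroup W] [InnerProductSpace ℂ W] [CompleteSpace W]

lemma sum_norm_sq_apply_le (Y : κ → W →L[ℂ] W) {D : ℝ} (hY : ‖∑ k, star (Y k) * Y k‖ ≤ D) (w : W) :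
    ∑ k, ‖Y k w‖ ^ 2 ≤ D * ‖w‖ ^ 2 := by
  have h : ((∑ k, ‖Y k w‖ ^ 2 : ℝ) : ℂ) = inner ℂ w ((∑ k, star (Y k) * Y k) w) := by
    rw [sum_apply, inner_sum]
    push_cast
    refine Finset.sum_congr rfl fun k _ => ?_
    change _ = inner ℂ w (star (Y k) (Y k w))
    rw [ContinuousLinearMap.star_eq_adjoint,
      ContinuousLinearMap.adjoint_inner_right, inner_self_eq_norm_sq_to_K]
    rfl
  have hnn : 0 ≤ ∑ k, ‖Y k w‖ ^ 2 := Finset.sum_nonneg fun _ _ => by positivity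
  calc ∑ k, ‖Y k w‖ ^ 2 = ‖((∑ k, ‖Y k w‖ ^ 2 : ℝ) : ℂ)‖ := by
        rw [Complex.norm_real, Real.norm_of_nonneg hnn]
    _ ≤ ‖w‖ * ‖(∑ k, star (Y k) * Y k) w‖ := by rw [h]; exact norm_inner_le_norm _ _
    _ ≤ ‖w‖ * (D * ‖w‖) := by
        gcongr
        exact (ContinuousLinearMap.le_opNorm _ _).trans (by gcongr)
    _ = D * ‖w‖ ^ 2 := by ring

lemma norm_sum_apply_sq_le (Y : κ → W →L[ℂ] W) {D : ℝ} (hY : ‖∑ k, Y k * star (Y k)‖ ≤ D)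
    (w : κ → W) : ‖∑ k, Y k (w k)‖ ^ 2 ≤ D * ∑ k, ‖w k‖ ^ 2 := by
  set z := ∑ k, Y k (w k) with hz
  have hcol : ∑ k, ‖star (Y k) z‖ ^ 2 ≤ D * ‖z‖ ^ 2 :=
    sum_norm_sq_apply_le (fun k => star (Y k)) (by simpa using hY) z
  have h1 : ‖z‖ ^ 2 ≤ ∑ k, ‖star (Y k) z‖ * ‖w k‖ := by
    have : ((‖z‖ ^ 2 : ℝ) : ℂ) = ∑ k, inner ℂ (star (Y k) z) (w k) := by
      have h2 : inner ℂ z z = ∑ k, inner ℂ (star (Y k) z) (w k) := by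
        conv_lhs => rw [hz, inner_sum]
        refine Finset.sum_congr rfl fun k _ => ?_
        rw [ContinuousLinearMap.star_eq_adjoint, ContinuousLinearMap.adjoint_inner_left]
      rw [← h2, inner_self_eq_norm_sq_to_K]
      push_cast
      rfl
    calc ‖z‖ ^ 2 = ‖((‖z‖ ^ 2 : ℝ) : ℂ)‖ := by
          rw [Complex.norm_real, Real.norm_of_nonneg (by positivity)]
      _ ≤ ∑ k, ‖star (Y k) z‖ * ‖w k‖ := by
          rw [this]
          exact (norm_sum_le _ _).trans (Finset.sum_le_sum fun k _ => norm_inner_le_norm _ _)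
  have h2 := Finset.sum_mul_sq_le_sq_mul_sq Finset.univ (fun k => ‖star (Y k) z‖) (fun k => ‖w k‖)
  have hw : 0 ≤ ∑ k, ‖w k‖ ^ 2 := Finset.sum_nonneg fun _ _ => by positivity
  have h3 : (‖z‖ ^ 2) * ‖z‖ ^ 2 ≤ (D * ∑ k, ‖w k‖ ^ 2) * ‖z‖ ^ 2 := by
    calc (‖z‖ ^ 2) * ‖z‖ ^ 2 = (‖z‖ ^ 2) ^ 2 := by ring
      _ ≤ (∑ k, ‖star (Y k) z‖ * ‖w k‖) ^ 2 := by gcongr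
      _ ≤ (∑ k, ‖star (Y k) z‖ ^ 2) * ∑ k, ‖w k‖ ^ 2 := h2
      _ ≤ (D * ‖z‖ ^ 2) * ∑ k, ‖w k‖ ^ 2 := by gcongr
      _ = _ := by ring
  have hD : 0 ≤ D := (norm_nonneg _).trans hY
  by_cases hz0 : ‖z‖ = 0
  · simpa [hz0] using mul_nonneg hD hw
  · exact le_of_mul_le_mul_right h3 (by positivity)

end RowColumn

/-! ### Moments in the group algebra of the free group -/

section Moments

open scoped Matrix.Norms.L2Operator

variable {F κ ν : Type*} [Group F] [Fintype κ] [Fintype ν] [DecidableEq ν]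

lemma MonoidAlgebra.coeff_sum_single_mul {R : Type*} [Semiring R] (s : κ → F) (y : κ → R)
    (c : MonoidAlgebra R F) (g : F) :
    ((∑ k, MonoidAlgebra.single (s k) (y k)) * c).coeff g = ∑ k, y k * c.coeff ((s k)⁻¹ * g) := by
  rw [Finset.sum_mul, MonoidAlgebra.coeff_sum, Finsupp.finsetSum_apply]
  refine Finset.sum_congr rfl fun k _ => ?_
  rw [MonoidAlgebra.coeff_single_mul_apply]

lemma PingPong.tsum_norm_sq_sum_single_mul_le {s : κ → F} {P : κ → Set F} (hsP : PingPong s P)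
    (y : κ → Matrix ν ν ℂ) {D : ℝ} (hcol : ‖∑ k, star (y k) * y k‖ ≤ D)
    (hrow : ‖∑ k, y k * star (y k)‖ ≤ D) (c : MonoidAlgebra (Matrix ν ν ℂ) F)
    (ξ : EuclideanSpace ℂ ν) :
    ∑' g, ENNReal.ofReal (‖Matrix.toEuclideanCLM (n := ν) (𝕜 := ℂ)
        (((∑ k, MonoidAlgebra.single (s k) (y k)) * c).coeff g) ξ‖ ^ 2) ≤
      ENNReal.ofReal (4 * D) * ∑' g, ENNReal.ofReal
        (‖Matrix.toEuclideanCLM (n := ν) (𝕜 := ℂ) (c.coeff g) ξ‖ ^ 2) := by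
  have hD : 0 ≤ D := (norm_nonneg _).trans hcol
  refine le_trans (le_of_eq ?_) (hsP.tsum_norm_sq_le
    (fun k => Matrix.toEuclideanCLM (n := ν) (𝕜 := ℂ) (y k)) hD
    (sum_norm_sq_apply_le _ ?_) (norm_sum_apply_sq_le _ ?_)
    (fun g => Matrix.toEuclideanCLM (n := ν) (𝕜 := ℂ) (c.coeff g) ξ))
  · refine tsum_congr fun g => ?_
    rw [MonoidAlgebra.coeff_sum_single_mul, map_sum, sum_apply]
    simp only [map_mul]
    rfl
  · simp_rw [← map_star, ← map_mul, ← map_sum]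
    exact hcol
  · simp_rw [← map_star, ← map_mul, ← map_sum]
    exact hrow

/-- The moments of a self-adjoint square in the group algebra of a group with a ping-pong
configuration. -/
theorem PingPong.tsum_norm_sq_pow_le [DecidableEq F] {s : κ → F} {P : κ → Set F}
    (hsP : PingPong s P)
    (y : κ → Matrix ν ν ℂ) {D : ℝ} (hcol : ‖∑ k, star (y k) * y k‖ ≤ D)
    (hrow : ‖∑ k, y k * star (y k)‖ ≤ D) (ξ : EuclideanSpace ℂ ν) (K : ℕ) :
    ∑' g, ENNReal.ofReal (‖Matrix.toEuclideanCLM (n := ν) (𝕜 := ℂ)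
        ((((∑ k, MonoidAlgebra.single (s k)⁻¹ (star (y k))) *
          (∑ k, MonoidAlgebra.single (s k) (y k))) ^ K).coeff g) ξ‖ ^ 2) ≤
      ENNReal.ofReal ((4 * D) ^ (2 * K) * ‖ξ‖ ^ 2) := by
  have hD : 0 ≤ D := (norm_nonneg _).trans hcol
  induction K with
  | zero =>
    rw [tsum_eq_single 1]
    · simp
    · intro g hg
      simp [MonoidAlgebra.one_def, MonoidAlgebra.coeff_single, Ne.symm hg]
  | succ K ih =>
    rw [pow_succ', mul_assoc]
    have hcol' : ‖∑ k, star (star (y k)) * star (y k)‖ ≤ D := by simpa only [star_star] using hrow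
    have hrow' : ‖∑ k, star (y k) * star (star (y k))‖ ≤ D := by simpa only [star_star] using hcol
    have h1 := hsP.inv.tsum_norm_sq_sum_single_mul_le (fun k => star (y k)) hcol' hrow'
      ((∑ k, MonoidAlgebra.single (s k) (y k)) *
        ((∑ k, MonoidAlgebra.single (s k)⁻¹ (star (y k))) *
          (∑ k, MonoidAlgebra.single (s k) (y k))) ^ K) ξ
    have h2 := hsP.tsum_norm_sq_sum_single_mul_le y hcol hrow
      (((∑ k, MonoidAlgebra.single (s k)⁻¹ (star (y k))) *
          (∑ k, MonoidAlgebra.single (s k) (y k))) ^ K) ξ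
    refine h1.trans ((mul_le_mul_right (h2.trans (mul_le_mul_right ih _)) _).trans_eq ?_)
    rw [← ENNReal.ofReal_mul (by positivity), ← ENNReal.ofReal_mul (by positivity)]
    congr 1
    ring

end Moments

/-! ### Finite permutation models -/

section PermutationModel

open scoped Matrix.Norms.L2Operator

/-- The representation of permutations by permutation matrices with coefficients in `R`. -/
def permMatrixHom (R ι : Type*) [Semiring R] [Fintype ι] [DecidableEq ι] :
    Equiv.Perm ι →* Matrix ι ι R where
  toFun σ := Matrix.of fun i j => if i = σ j then (1 : R) else 0
  map_one' := by
    ext i j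
    simp only [Matrix.of_apply, Matrix.one_apply, Equiv.Perm.coe_one, id_eq]
    rfl
  map_mul' σ τ := by
    ext i j
    simp only [Matrix.mul_apply, Matrix.of_apply, Equiv.Perm.coe_mul, Function.comp_apply, mul_ite,
      mul_one, mul_zero, Finset.sum_ite_eq', Finset.mem_univ, if_true]
    rfl

lemma permMatrixHom_apply {R ι : Type*} [Semiring R] [Fintype ι] [DecidableEq ι]
    (σ : Equiv.Perm ι) (i j : ι) : permMatrixHom R ι σ i j = if i = σ j then 1 else 0 := rfl

variable {R F ι : Type*} [Semiring R] [Group F] [Fintype ι] [DecidableEq ι]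

/-- The extension of a permutation action of `F` to matrices over the coefficient ring of
the group algebra. -/
def permModel (R : Type*) [Semiring R] (φ : F →* Equiv.Perm ι) :
    MonoidAlgebra R F →+* Matrix ι ι R :=
  MonoidAlgebra.liftNCRingHom (Matrix.scalar ι) ((permMatrixHom R ι).comp φ) fun r g => by
    change _ * _ = _ * _
    ext i j
    simp [permMatrixHom_apply, Matrix.scalar_apply]

lemma permModel_single (φ : F →* Equiv.Perm ι) (g : F) (r : R) (i j : ι) :
    permModel R φ (MonoidAlgebra.single g r) i j = if i = φ g j then r else 0 := by
  simp [permModel, permMatrixHom_apply, Matrix.scalar_apply]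

lemma permModel_apply [DecidableEq F] (φ : F →* Equiv.Perm ι) (c : MonoidAlgebra R F) (i j : ι) :
    permModel R φ c i j = ∑ g ∈ c.coeff.support, if i = φ g j then c.coeff g else 0 := by
  conv_lhs => rw [← MonoidAlgebra.sum_coeff_single c]
  simp_rw [Finsupp.sum, map_sum, Matrix.sum_apply, permModel_single]

lemma sum_permModel_apply [DecidableEq F] (φ : F →* Equiv.Perm ι) (c : MonoidAlgebra R F)
    (hφ : ∀ g ∈ c.coeff.support, ∀ h ∈ c.coeff.support, ∀ i, φ g i = φ h i → g = h)
    (N : R → ℝ) (hN : N 0 = 0) (j : ι) :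
    ∑ i, N (permModel R φ c i j) = ∑ g ∈ c.coeff.support, N (c.coeff g) := by
  have hval : ∀ g ∈ c.coeff.support, permModel R φ c (φ g j) j = c.coeff g := by
    intro g hg
    rw [permModel_apply, Finset.sum_eq_single_of_mem g hg]
    · simp
    · intro h hh hne
      exact if_neg fun he => hne (hφ g hg h hh j he).symm
  have hinj : Set.InjOn (fun g => φ g j) (c.coeff.support : Set F) :=
    fun g hg h hh he => hφ g hg h hh j he
  rw [← Finset.sum_subset (Finset.subset_univ (c.coeff.support.image fun g => φ g j)),
    Finset.sum_image hinj]
  · exact Finset.sum_congr rfl fun g hg => by rw [hval g hg]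
  · intro i _ hi
    rw [permModel_apply, Finset.sum_eq_zero, hN]
    intro g hg
    refine if_neg fun he => hi ?_
    exact Finset.mem_image.mpr ⟨g, hg, he.symm⟩

variable {κ ν : Type*} [Fintype κ] [DecidableEq κ] [Fintype ν] [DecidableEq ν]

/-- Finite permutation models of free generators whose matrix-valued moments are controlled up
to a given order. -/
theorem exists_perm_moment_le (y : κ → Matrix ν ν ℂ) {D : ℝ}
    (hcol : ‖∑ k, star (y k) * y k‖ ≤ D) (hrow : ‖∑ k, y k * star (y k)‖ ≤ D) (K : ℕ) :
    ∃ (n : ℕ) (_ : 0 < n) (σ : κ → Equiv.Perm (Fin n)),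
      (∀ k l i, σ k i = σ l i → k = l) ∧
      ∀ X : Matrix (Fin n) (Fin n) (Matrix ν ν ℂ),
        (X = Matrix.of fun i j => ∑ k, if i = σ k j then y k else 0) →
        ∀ (j : Fin n) (ξ : EuclideanSpace ℂ ν),
          ∑ i, ‖Matrix.toEuclideanCLM (n := ν) (𝕜 := ℂ) (((star X * X) ^ K) i j) ξ‖ ^ 2 ≤
            (4 * D) ^ (2 * K) * ‖ξ‖ ^ 2 := by
  classical
  have hD : 0 ≤ D := (norm_nonneg _).trans hcol
  set a : MonoidAlgebra (Matrix ν ν ℂ) (FreeGroup κ) :=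
    ∑ k, MonoidAlgebra.single (FreeGroup.of k) (y k) with ha
  set b : MonoidAlgebra (Matrix ν ν ℂ) (FreeGroup κ) :=
    ∑ k, MonoidAlgebra.single (FreeGroup.of k)⁻¹ (star (y k)) with hb
  set c := (b * a) ^ K with hc
  obtain ⟨n, hn, φ, hφ⟩ := FreeGroup.exists_perm_separating
    (c.coeff.support ∪ Finset.univ.image FreeGroup.of)
  refine ⟨n, hn, fun k => φ (FreeGroup.of k), fun k l i h => ?_, ?_⟩
  · exact FreeGroup.of_injective (hφ _ (by simp) _ (by simp) i h)
  rintro X rfl j ξ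
  have hXa : (Matrix.of fun i j => ∑ k, if i = φ (FreeGroup.of k) j then y k else 0) =
      permModel (Matrix ν ν ℂ) φ a := by
    ext1 i j
    simp [ha, map_sum, Matrix.sum_apply, permModel_single]
  have hXb : star (permModel (Matrix ν ν ℂ) φ a) = permModel (Matrix ν ν ℂ) φ b := by
    ext1 i j
    simp only [ha, hb, map_sum, Matrix.star_apply, Matrix.sum_apply, permModel_single, star_sum]
    refine Finset.sum_congr rfl fun k _ => ?_
    rw [_root_.map_inv, apply_ite star, star_zero]
    refine if_congr ?_ rfl rfl
    rw [Equiv.Perm.eq_inv_iff_eq, eq_comm]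
  rw [hXa, hXb, ← map_mul, ← map_pow, ← hc]
  rw [sum_permModel_apply φ c
    (fun g hg h hh => hφ g (Finset.mem_union_left _ hg) h (Finset.mem_union_left _ hh))
    (fun r => ‖Matrix.toEuclideanCLM (n := ν) (𝕜 := ℂ) r ξ‖ ^ 2) (by simp) j]
  have hfin := (ENNReal.sum_le_tsum c.coeff.support).trans
    ((FreeGroup.pingPong κ).tsum_norm_sq_pow_le y hcol hrow ξ K)
  rw [← ENNReal.ofReal_sum_of_nonneg fun _ _ => by positivity] at hfin
  exact (ENNReal.ofReal_le_ofReal_iff (by positivity)).mp hfin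

end PermutationModel

/-! ### Compression by projections -/

section Compression

open scoped Matrix.Norms.L2Operator

lemma Matrix.trace_conjTranspose_mul_self_eq_sum {κ ι : Type*} [Fintype κ] [Fintype ι]
    (M : Matrix κ ι ℂ) : (M.conjTranspose * M).trace = ((∑ i, ∑ j, ‖M i j‖ ^ 2 : ℝ) : ℂ) := by
  rw [Finset.sum_comm]
  simp only [Matrix.trace, Matrix.diag_apply, Matrix.mul_apply, Matrix.conjTranspose_apply]
  push_cast
  refine Finset.sum_congr rfl fun i _ => Finset.sum_congr rfl fun j _ => ?_
  rw [← Complex.conj_mul']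
  rfl

/-- A matrix with small normalized Hilbert-Schmidt norm has small operator norm after compression
by a projection of small normalized codimension. -/
theorem exists_projection_norm_mul_le {κ ι : Type*} [Fintype κ] [Fintype ι] [DecidableEq ι]
    (Q : Matrix κ ι ℂ) {β δ : ℝ} (hβ : 0 < β) (hδ : 0 < δ)
    (hQ : ∑ i, ∑ j, ‖Q i j‖ ^ 2 ≤ Fintype.card ι * β) :
    ∃ h : Matrix ι ι ℂ, h.conjTranspose = h ∧ h * h = h ∧ ‖Q * h‖ ^ 2 ≤ β / δ ∧
      ∑ i, ∑ j, ‖(1 - h) i j‖ ^ 2 ≤ Fintype.card ι * δ := by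
  classical
  have hpsd : (Q.conjTranspose * Q).PosSemidef := Matrix.posSemidef_conjTranspose_mul_self Q
  have hA := hpsd.isHermitian
  set l := hA.eigenvalues with hl
  have hl0 : ∀ i, 0 ≤ l i := hpsd.eigenvalues_nonneg
  let f := Unitary.conjStarAlgAut ℂ (Matrix ι ι ℂ) hA.eigenvectorUnitary
  have hf : Q.conjTranspose * Q = f (Matrix.diagonal (fun i => (l i : ℂ))) := hA.spectral_theorem
  have hftr : ∀ M, (f M).trace = M.trace := fun M => by
    rw [Unitary.conjStarAlgAut_apply, Matrix.trace_mul_cycle, Unitary.coe_star_mul_self, one_mul]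
  let p : ι → ℂ := fun i => if l i ≤ β / δ then 1 else 0
  have hpp : ∀ i, p i * p i = p i := fun i => by simp [p]
  have hps : ∀ i, star (p i) = p i := fun i => by simp only [p]; split_ifs <;> simp
  have hh : (f (Matrix.diagonal p)).conjTranspose = f (Matrix.diagonal p) := by
    change star (f _) = _
    rw [← map_star, Matrix.star_eq_conjTranspose, Matrix.diagonal_conjTranspose]
    congr 2
    ext i
    exact hps i
  have hhh : f (Matrix.diagonal p) * f (Matrix.diagonal p) = f (Matrix.diagonal p) := by
    rw [← map_mul, Matrix.diagonal_mul_diagonal]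
    simp_rw [hpp]
  refine ⟨f (Matrix.diagonal p), hh, hhh, ?_, ?_⟩
  · have : ‖f (Matrix.diagonal fun i => p i * l i * p i)‖ ≤ β / δ := by
      rw [StarAlgEquiv.norm_map, Matrix.l2_opNorm_diagonal]
      refine (pi_norm_le_iff_of_nonneg (by positivity)).mpr fun i => ?_
      simp only [p]
      split_ifs with hi
      · simpa [abs_of_nonneg (hl0 i)] using hi
      · simp; positivity
    rw [sq, ← Matrix.l2_opNorm_conjTranspose_mul_self, Matrix.conjTranspose_mul, hh,
      Matrix.mul_assoc, ← Matrix.mul_assoc Q.conjTranspose, hf, ← map_mul, ← map_mul,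
      Matrix.diagonal_mul_diagonal, Matrix.diagonal_mul_diagonal]
    simpa only [mul_assoc] using this
  · have h1 : (∑ i, ∑ j, ‖(1 - f (Matrix.diagonal p)) i j‖ ^ 2 : ℝ) =
        ∑ i, (if l i ≤ β / δ then (0 : ℝ) else 1) := by
      have h2 : (((∑ i, ∑ j, ‖(1 - f (Matrix.diagonal p)) i j‖ ^ 2 : ℝ) : ℝ) : ℂ) =
          ((∑ i, (if l i ≤ β / δ then (0 : ℝ) else 1) : ℝ) : ℂ) := by
        rw [← Matrix.trace_conjTranspose_mul_self_eq_sum, Matrix.conjTranspose_sub,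
          Matrix.conjTranspose_one, hh, mul_sub, mul_one, sub_mul, hhh, one_mul, sub_self,
          sub_zero, Matrix.trace_sub, hftr, Matrix.trace_one, Matrix.trace_diagonal]
        push_cast
        rw [← Finset.card_univ, Finset.card_eq_sum_ones]
        push_cast
        rw [← Finset.sum_sub_distrib]
        refine Finset.sum_congr rfl fun i _ => ?_
        simp only [p]
        split_ifs <;> simp
      exact_mod_cast h2
    have h3 : (∑ i, l i : ℝ) = ∑ i, ∑ j, ‖Q i j‖ ^ 2 := by
      have h4 : ((∑ i, l i : ℝ) : ℂ) = ((∑ i, ∑ j, ‖Q i j‖ ^ 2 : ℝ) : ℂ) := by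
        rw [← Matrix.trace_conjTranspose_mul_self_eq_sum, hf, hftr, Matrix.trace_diagonal]
        push_cast
        rfl
      exact_mod_cast h4
    have h5 : (β / δ) * ∑ i, (if l i ≤ β / δ then (0 : ℝ) else 1) ≤ ∑ i, l i := by
      rw [Finset.mul_sum]
      refine Finset.sum_le_sum fun i _ => ?_
      split_ifs with hi
      · simpa using hl0 i
      · simpa using (not_le.mp hi).le
    rw [h1]
    rw [h3] at h5
    have h6 := h5.trans hQ
    rw [div_mul_eq_mul_div, div_le_iff₀ hδ] at h6
    exact le_of_mul_le_mul_left (by linarith) hβ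

end Compression

/-! ### Compressed permutation models -/

section CompressedModel

open scoped Matrix.Norms.L2Operator

lemma Matrix.norm_submatrix_one_le {m m' : Type*} [Fintype m] [DecidableEq m] [Fintype m']
    [DecidableEq m'] {e : m' → m} (he : Function.Injective e) :
    ‖(1 : Matrix m m ℂ).submatrix e id‖ ≤ 1 := by
  have h1 : ((1 : Matrix m m ℂ).submatrix e id) * ((1 : Matrix m m ℂ).submatrix e id).conjTranspose
      = 1 := by
    ext i j
    simp [Matrix.mul_apply, Matrix.one_apply, he.eq_iff]
  have h2 : ‖(1 : Matrix m' m' ℂ)‖ ≤ 1 := by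
    rw [← Matrix.diagonal_one, Matrix.l2_opNorm_diagonal]
    exact (pi_norm_le_iff_of_nonneg zero_le_one).mpr fun i => by simp
  rw [← h1] at h2
  have h3 := Matrix.l2_opNorm_conjTranspose_mul_self
    ((1 : Matrix m m ℂ).submatrix e id).conjTranspose
  rw [Matrix.conjTranspose_conjTranspose, Matrix.l2_opNorm_conjTranspose] at h3
  rw [h3] at h2
  nlinarith [norm_nonneg ((1 : Matrix m m ℂ).submatrix e id)]

/-- Moving an index from the rows to the columns multiplies the norm at most by its range. -/
lemma Matrix.norm_unstack_le {ι ι' ν μ : Type*} [Fintype ι] [DecidableEq ι] [Fintype ι']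
    [DecidableEq ι'] [Fintype ν] [DecidableEq ν] [Fintype μ] [DecidableEq μ]
    (P : Matrix (ι × ν × μ) ι' ℂ) :
    ‖(Matrix.of fun p q => P (p.1, p.2, q.2) q.1 : Matrix (ι × ν) (ι' × μ) ℂ)‖ ≤
      Fintype.card μ * ‖P‖ := by
  have h : (Matrix.of fun p q => P (p.1, p.2, q.2) q.1 : Matrix (ι × ν) (ι' × μ) ℂ) =
      ∑ b : μ, (1 : Matrix (ι × ν × μ) (ι × ν × μ) ℂ).submatrix
          (fun p : ι × ν => (p.1, p.2, b)) id *
        P * (1 : Matrix (ι' × μ) (ι' × μ) ℂ).submatrix (fun j => (j, b)) id := by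
    ext ⟨i, a⟩ ⟨j, b⟩
    simp [Matrix.sum_apply, Matrix.mul_apply, Matrix.one_apply, Prod.ext_iff, ite_and,
      Fintype.sum_prod_type]
  rw [h]
  refine (norm_sum_le _ _).trans ?_
  refine (Finset.sum_le_card_nsmul _ _ ‖P‖ fun b _ => ?_).trans_eq (by simp)
  have hS : ‖(1 : Matrix (ι × ν × μ) (ι × ν × μ) ℂ).submatrix
      (fun p : ι × ν => (p.1, p.2, b)) id‖ ≤ 1 :=
    Matrix.norm_submatrix_one_le fun p q h => by simpa [Prod.ext_iff] using h
  have hR : ‖(1 : Matrix (ι' × μ) (ι' × μ) ℂ).submatrix (fun j : ι' => (j, b)) id‖ ≤ 1 :=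
    Matrix.norm_submatrix_one_le fun p q h => by simpa using h
  refine (Matrix.l2_opNorm_mul _ _).trans ?_
  refine (mul_le_mul_of_nonneg_left hR (norm_nonneg _)).trans ?_
  rw [mul_one]
  refine (Matrix.l2_opNorm_mul _ _).trans ?_
  exact mul_le_of_le_one_left (norm_nonneg _) hS

lemma Matrix.cstarNorm_comp {ι ν : Type*} [Fintype ι] [DecidableEq ι] [Fintype ν] [DecidableEq ν]
    (M : Matrix ι ι (Matrix ν ν ℂ)) : cstarNorm M = ‖Matrix.compAlgEquiv ι ν ℂ ℂ M‖ := by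
  rw [← cstarNorm_eq_norm, cstarNorm_map]
  intro b
  ext ⟨i, a⟩ ⟨j, c⟩
  simp [Matrix.star_apply]

variable {κ ν : Type*} [Fintype κ] [DecidableEq κ] [Fintype ν] [DecidableEq ν]

/-- Matrix coefficients with row and column norms at most `√D` admit finite permutation models
of disjoint supports which, compressed by a projection of small codimension, have norm almost
`2√D`. -/
theorem exists_perm_projection_cstarNorm_le (y : κ → Matrix ν ν ℂ) {D ε δ : ℝ} (hD0 : 0 < D)
    (hε : 0 < ε) (hδ : 0 < δ)
    (hcol : ‖∑ k, star (y k) * y k‖ ≤ D) (hrow : ‖∑ k, y k * star (y k)‖ ≤ D) :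
    ∃ (n : ℕ) (_ : 0 < n) (σ : κ → Equiv.Perm (Fin n)) (h : Matrix (Fin n) (Fin n) ℂ),
      (∀ k l i, σ k i = σ l i → k = l) ∧
      ∑ i, ∑ j, ‖(1 - h) i j‖ ^ 2 ≤ n * δ ∧
      cstarNorm (Matrix.of fun i j => ∑ k, h ((σ k).symm i) j • y k) ^ 2 ≤ 4 * D * (1 + ε) := by
  classical
  set N : ℝ := (Fintype.card ν : ℝ) with hN
  have hN0 : 0 ≤ N := Nat.cast_nonneg _
  obtain ⟨r, hr⟩ := pow_unbounded_of_one_lt (N * Real.sqrt ((N + 1) / δ))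
    (show 1 < 1 + ε by linarith)
  have hr' : N * Real.sqrt ((N + 1) / δ) ≤ (1 + ε) ^ 2 ^ r :=
    hr.le.trans (pow_le_pow_right₀ (by linarith) Nat.lt_two_pow_self.le)
  obtain ⟨n, hn, σ, hσ, hX⟩ := exists_perm_moment_le y hcol hrow (2 ^ r)
  set X : Matrix (Fin n) (Fin n) (Matrix ν ν ℂ) :=
    Matrix.of fun i j => ∑ k, if i = σ k j then y k else 0 with hXdef
  specialize hX X rfl
  set T := (star X * X) ^ 2 ^ r with hT
  let Q : Matrix (Fin n × ν × ν) (Fin n) ℂ := Matrix.of fun p j => T p.1 j p.2.1 p.2.2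
  have hQ : ∑ p, ∑ j, ‖Q p j‖ ^ 2 ≤
      Fintype.card (Fin n) * ((N + 1) * (4 * D) ^ (2 * 2 ^ r)) := by
    rw [Finset.sum_comm]
    rw [← Finset.card_univ, ← nsmul_eq_mul]
    refine Finset.sum_le_card_nsmul _ _ _ fun j _ => ?_
    have h1 : ∑ p, ‖Q p j‖ ^ 2 = ∑ b : ν, ∑ i, ‖Matrix.toEuclideanCLM (n := ν) (𝕜 := ℂ) (T i j)
        (EuclideanSpace.single b 1)‖ ^ 2 := by
      rw [Fintype.sum_prod_type]
      conv_rhs => rw [Finset.sum_comm]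
      refine Finset.sum_congr rfl fun i _ => ?_
      rw [Fintype.sum_prod_type, Finset.sum_comm]
      refine Finset.sum_congr rfl fun b _ => ?_
      rw [EuclideanSpace.norm_sq_eq]
      refine Finset.sum_congr rfl fun a _ => ?_
      simp [Q, Matrix.ofLp_toEuclideanCLM]
    rw [h1]
    refine (Finset.sum_le_card_nsmul _ _ ((4 * D) ^ (2 * 2 ^ r)) fun b _ => ?_).trans ?_
    · simpa using hX j (EuclideanSpace.single b 1)
    · rw [nsmul_eq_mul, Finset.card_univ, ← hN]
      gcongr
      linarith
  obtain ⟨h, hh, hhh, hQh, hsum⟩ := exists_projection_norm_mul_le Q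
    (by positivity) hδ hQ
  refine ⟨n, hn, σ, h, hσ, by simpa using hsum, ?_⟩
  let f := Matrix.compAlgEquiv (Fin n) ν ℂ ℂ
  have hfstar : ∀ b, f (star b) = star (f b) := fun b => by
    ext ⟨i, a⟩ ⟨j, c⟩
    simp [f, Matrix.star_apply]
  let p : Matrix (Fin n) (Fin n) (Matrix ν ν ℂ) := h.map (algebraMap ℂ (Matrix ν ν ℂ))
  have hp : star p = p := by
    conv_rhs => rw [show p = h.map (algebraMap ℂ (Matrix ν ν ℂ)) from rfl, ← hh]
    ext1 i j
    simp only [p, Matrix.star_apply, Matrix.map_apply, Matrix.conjTranspose_apply]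
    rw [algebraMap_star_comm]
  have hpp : p * p = p := by
    conv_rhs => rw [show p = h.map (algebraMap ℂ (Matrix ν ν ℂ)) from rfl, ← hhh]
    exact (Matrix.map_mul (f := algebraMap ℂ (Matrix ν ν ℂ))).symm
  have hZ : (Matrix.of fun i j => ∑ k, h ((σ k).symm i) j • y k) = X * p := by
    ext1 i j
    simp only [Matrix.of_apply, Matrix.mul_apply, hXdef, p, Matrix.map_apply, Finset.sum_mul]
    rw [Finset.sum_comm]
    refine Finset.sum_congr rfl fun k _ => ?_
    rw [Finset.sum_eq_single_of_mem ((σ k).symm i) (Finset.mem_univ _)]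
    · rw [if_pos (by simp), Algebra.smul_def, Algebra.commutes]
    · intro l _ hl
      rw [if_neg, zero_mul]
      rintro rfl
      simp at hl
  have hTh : ‖f (T * p)‖ ≤ N * ‖Q * h‖ := by
    refine le_of_eq_of_le ?_ (Matrix.norm_unstack_le (Q * h))
    congr 1
    ext ⟨i, a⟩ ⟨j, b⟩
    simp [f, p, Q, Matrix.mul_apply, Matrix.sum_apply, Matrix.algebraMap_matrix_apply]
  have hmain := norm_mul_pow_le_of_projection (f X) (f p) (by rw [← hfstar, hp])
    (by rw [← map_mul, hpp]) r
  rw [← hfstar, ← map_mul, ← map_mul, ← map_pow, ← map_mul, ← hT] at hmain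
  rw [hZ, Matrix.cstarNorm_comp]
  change ‖f (X * p)‖ ^ 2 ≤ _
  have hQh' : ‖Q * h‖ ≤ Real.sqrt ((N + 1) / δ) * (4 * D) ^ 2 ^ r := by
    refine le_of_pow_le_pow_left₀ two_ne_zero (by positivity) (hQh.trans_eq ?_)
    rw [mul_pow (Real.sqrt _), Real.sq_sqrt (by positivity), pow_mul']
    ring
  refine le_of_pow_le_pow_left₀ (n := 2 ^ r) (by positivity) (by positivity) ?_
  calc (‖f (X * p)‖ ^ 2) ^ 2 ^ r ≤ N * (Real.sqrt ((N + 1) / δ) * (4 * D) ^ 2 ^ r) :=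
        hmain.trans (hTh.trans (by gcongr))
    _ = (N * Real.sqrt ((N + 1) / δ)) * (4 * D) ^ 2 ^ r := by ring
    _ ≤ (1 + ε) ^ 2 ^ r * (4 * D) ^ 2 ^ r := by gcongr
    _ = (4 * D * (1 + ε)) ^ 2 ^ r := by rw [← mul_pow, mul_comm]

end CompressedModel

/-! ### Tracial estimate for compressed permutation models -/

section TracialEstimate

variable {κ ι H : Type*} [Fintype κ] [Fintype ι] [DecidableEq ι]
  [NormedAddCommGroup H]

lemma sum_norm_sq_sum_ite_perm (σ : κ → Equiv.Perm ι) (hσ : ∀ k l i, σ k i = σ l i → k = l)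
    (w : κ → H) :
    ∑ i, ∑ j, ‖∑ k, if i = σ k j then w k else 0‖ ^ 2 = Fintype.card ι * ∑ k, ‖w k‖ ^ 2 := by
  classical
  have h1 : ∀ i j, ‖∑ k, if i = σ k j then w k else 0‖ ^ 2 =
      ∑ k, if i = σ k j then ‖w k‖ ^ 2 else 0 := by
    intro i j
    by_cases h : ∃ k, i = σ k j
    · obtain ⟨k, rfl⟩ := h
      have h2 : ∀ l, l ≠ k → ¬ σ k j = σ l j := fun l hl he => hl (hσ _ _ _ he).symm
      rw [Finset.sum_eq_single k (fun l _ hl => if_neg (h2 l hl)) (by simp),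
        Finset.sum_eq_single k (fun l _ hl => if_neg (h2 l hl)) (by simp), if_pos rfl, if_pos rfl]
    · push Not at h
      simp [h]
  simp_rw [h1]
  rw [Finset.sum_comm, ← Finset.card_univ, ← nsmul_eq_mul]
  refine Finset.sum_eq_card_nsmul fun j _ => ?_
  rw [Finset.sum_comm]
  simp

/-- A map dominated in `ℓ₂`-mean on a compressed permutation model of a family is dominated on the
family itself, up to the defect of the compression. -/
theorem sqrt_sum_norm_sq_le_of_perm [NormedSpace ℂ H] {E : Type*} [AddCommGroup E] [Module ℂ E]
    [Nonempty ι]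
    (v : E →ₗ[ℂ] H) (x : κ → E) (σ : κ → Equiv.Perm ι) (hσ : ∀ k l i, σ k i = σ l i → k = l)
    (h : Matrix ι ι ℂ) {δ : ℝ} (hδ : 0 ≤ δ)
    (hh : ∑ i, ∑ j, ‖(1 - h) i j‖ ^ 2 ≤ Fintype.card ι * δ) :
    Real.sqrt (∑ k, ‖v (x k)‖ ^ 2) ≤
      Real.sqrt ((Fintype.card ι : ℝ)⁻¹ *
        ∑ i, ∑ j, ‖v (∑ k, h ((σ k).symm i) j • x k)‖ ^ 2) +
      (∑ k, ‖v (x k)‖) * Real.sqrt δ := by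
  have hn : (0 : ℝ) < Fintype.card ι := by exact_mod_cast Fintype.card_pos
  let a : PiLp 2 (fun _ : ι × ι => H) :=
    WithLp.toLp 2 fun p => ∑ k, if p.1 = σ k p.2 then v (x k) else 0
  let b : PiLp 2 (fun _ : ι × ι => H) :=
    WithLp.toLp 2 fun p => v (∑ k, h ((σ k).symm p.1) p.2 • x k)
  let c : κ → PiLp 2 (fun _ : ι × ι => H) := fun k =>
    WithLp.toLp 2 fun p => (1 - h) ((σ k).symm p.1) p.2 • v (x k)
  have habc : a = b + ∑ k, c k := by
    ext p
    simp only [a, b, c, PiLp.add_apply, WithLp.ofLp_sum, Finset.sum_apply, map_sum, map_smul,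
      ← Finset.sum_add_distrib]
    refine Finset.sum_congr rfl fun k _ => ?_
    rw [Matrix.sub_apply, sub_smul, add_sub_cancel, Matrix.one_apply]
    simp only [Equiv.symm_apply_eq, ite_smul, one_smul, zero_smul]
  have ha : ‖a‖ = Real.sqrt (Fintype.card ι) * Real.sqrt (∑ k, ‖v (x k)‖ ^ 2) := by
    rw [PiLp.norm_eq_of_L2, Fintype.sum_prod_type, ← Real.sqrt_mul hn.le]
    exact congrArg Real.sqrt (sum_norm_sq_sum_ite_perm σ hσ _)
  have hb : ‖b‖ = Real.sqrt (Fintype.card ι) * Real.sqrt ((Fintype.card ι : ℝ)⁻¹ *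
        ∑ i, ∑ j, ‖v (∑ k, h ((σ k).symm i) j • x k)‖ ^ 2) := by
    rw [PiLp.norm_eq_of_L2, Fintype.sum_prod_type, ← Real.sqrt_mul hn.le,
      mul_inv_cancel_left₀ hn.ne']
  have hc : ∀ k, ‖c k‖ ≤ Real.sqrt (Fintype.card ι) * (‖v (x k)‖ * Real.sqrt δ) := by
    intro k
    have h1 : ∑ i, ∑ j, ‖(1 - h) ((σ k).symm i) j • v (x k)‖ ^ 2 =
        ‖v (x k)‖ ^ 2 * ∑ i, ∑ j, ‖(1 - h) i j‖ ^ 2 := by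
      rw [Equiv.sum_comp (σ k).symm (fun i => ∑ j, ‖(1 - h) i j • v (x k)‖ ^ 2)]
      simp_rw [norm_smul, mul_pow, Finset.mul_sum]
      exact Finset.sum_congr rfl fun i _ => Finset.sum_congr rfl fun j _ => mul_comm _ _
    rw [PiLp.norm_eq_of_L2, Fintype.sum_prod_type]
    refine Real.sqrt_le_iff.mpr ⟨by positivity, ?_⟩
    refine h1.trans_le ?_
    rw [mul_pow, mul_pow, Real.sq_sqrt hn.le, Real.sq_sqrt hδ]
    calc ‖v (x k)‖ ^ 2 * ∑ i, ∑ j, ‖(1 - h) i j‖ ^ 2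
        ≤ ‖v (x k)‖ ^ 2 * (Fintype.card ι * δ) := by gcongr
      _ = _ := by ring
  have hle : ‖a‖ ≤ ‖b‖ + ∑ k, ‖c k‖ := by
    rw [habc]
    exact (norm_add_le _ _).trans (by gcongr; exact norm_sum_le _ _)
  have hs : 0 < Real.sqrt (Fintype.card ι) := Real.sqrt_pos.mpr hn
  refine le_of_mul_le_mul_left ?_ hs
  rw [← ha, mul_add, ← hb, Finset.sum_mul, Finset.mul_sum]
  exact hle.trans (by gcongr with k; exact hc k)

end TracialEstimate

/-! ### Matrices over a C*-algebra -/

section MatrixNorm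

lemma cstarNorm_map_le {B B' : Type*} [CStarAlgebra B] [Ring B'] [Algebra ℂ B'] [Star B']
    (f : B →ₐ[ℂ] B') (hf : ∀ b, f (star b) = star (f b)) (b : B) : cstarNorm (f b) ≤ ‖b‖ := by
  rw [← cstarNorm_eq_norm, cstarNorm, cstarNorm, ← hf, ← map_mul]
  refine Real.sqrt_le_sqrt (ENNReal.toReal_mono ?_ ?_)
  · rw [(IsSelfAdjoint.star_mul_self b).spectralRadius_eq_nnnorm]
    exact ENNReal.coe_ne_top
  · exact biSup_mono fun k hk => AlgHom.spectrum_apply_subset f _ hk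

variable {A ι : Type*} [CStarAlgebra A] [Fintype ι] [DecidableEq ι]

lemma Matrix.exists_cstarNorm_eq.{u, w} (A : Type u) (ι : Type w) [CStarAlgebra A] [Fintype ι]
    [DecidableEq ι] :
    ∃ (B : Type (max u w)) (_ : CStarAlgebra B) (f : Matrix ι ι A ≃⋆ₐ[ℂ] B),
      (∀ M, cstarNorm M = ‖f M‖) ∧ ∀ M i j, ‖M i j‖ ≤ ‖f M‖ := by
  let _ := CStarAlgebra.spectralOrder A
  have := CStarAlgebra.spectralOrderedRing A
  refine ⟨CStarMatrix ι ι A, inferInstance, CStarMatrix.ofMatrixStarAlgEquiv, fun M => ?_,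
    fun M i j => ?_⟩
  · rw [← cstarNorm_eq_norm]
    exact (cstarNorm_map (CStarMatrix.ofMatrixStarAlgEquiv (n := ι) (A := A)).toAlgEquiv
      (map_star CStarMatrix.ofMatrixStarAlgEquiv) M).symm
  · exact CStarMatrix.norm_entry_le_norm (M := CStarMatrix.ofMatrix M)

namespace Matrix

lemma cstarNorm_mul_le (M M' : Matrix ι ι A) : cstarNorm (M * M') ≤ cstarNorm M * cstarNorm M' := by
  obtain ⟨B, _, f, hf, -⟩ := exists_cstarNorm_eq A ι
  simpa only [hf, map_mul] using norm_mul_le _ _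

lemma cstarNorm_sum_le {κ : Type*} (s : Finset κ) (M : κ → Matrix ι ι A) :
    cstarNorm (∑ k ∈ s, M k) ≤ ∑ k ∈ s, cstarNorm (M k) := by
  obtain ⟨B, _, f, hf, -⟩ := exists_cstarNorm_eq A ι
  simpa only [hf, map_sum] using norm_sum_le _ _

lemma cstarNorm_smul (c : ℂ) (M : Matrix ι ι A) : cstarNorm (c • M) = ‖c‖ * cstarNorm M := by
  obtain ⟨B, _, f, hf, -⟩ := exists_cstarNorm_eq A ι
  simpa only [hf, map_smul] using norm_smul _ _

lemma cstarNorm_star_mul_self (M : Matrix ι ι A) : cstarNorm (star M * M) = cstarNorm M ^ 2 := by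
  obtain ⟨B, _, f, hf, -⟩ := exists_cstarNorm_eq A ι
  rw [sq]
  simpa only [hf, map_mul, map_star] using CStarRing.norm_star_mul_self

lemma cstarNorm_star (M : Matrix ι ι A) : cstarNorm (star M) = cstarNorm M := by
  obtain ⟨B, _, f, hf, -⟩ := exists_cstarNorm_eq A ι
  simpa only [hf, map_star] using norm_star _

lemma norm_apply_le_cstarNorm (M : Matrix ι ι A) (i j : ι) : ‖M i j‖ ≤ cstarNorm M := by
  obtain ⟨B, _, f, hf, hf'⟩ := exists_cstarNorm_eq A ι
  exact (hf' M i j).trans_eq (hf M).symm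

lemma cstarNorm_scalar_le (a : A) : cstarNorm (Matrix.scalar ι a) ≤ ‖a‖ :=
  cstarNorm_map_le (B' := Matrix ι ι A) (AlgHom.mk (Matrix.scalar ι) fun _ => rfl) (fun b => by
    change diagonal _ = star (diagonal _)
    rw [star_eq_conjTranspose, diagonal_conjTranspose]
    rfl) a

open scoped Matrix.Norms.L2Operator in
lemma cstarNorm_map_algebraMap_le (α : Matrix ι ι ℂ) :
    cstarNorm (α.map (algebraMap ℂ A)) ≤ ‖α‖ :=
  cstarNorm_map_le (B' := Matrix ι ι A) (AlgHom.mapMatrix (Algebra.ofId ℂ A)) (fun b => by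
    ext i j
    exact algebraMap_star_comm _) α

lemma cstarNorm_single (i : ι) (a : A) : cstarNorm (Matrix.single i i a) = ‖a‖ := by
  refine le_antisymm ?_ (by simpa using norm_apply_le_cstarNorm (Matrix.single i i a) i i)
  have h1 : cstarNorm (Matrix.single i i (1 : A)) ≤ 1 := by
    have h := cstarNorm_star_mul_self (Matrix.single i i (1 : A))
    rw [star_eq_conjTranspose, conjTranspose_single, single_mul_single_same, star_one, one_mul,
      sq] at h
    have h0 : 0 ≤ cstarNorm (Matrix.single i i (1 : A)) := Real.sqrt_nonneg _
    nlinarith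
  have h2 : Matrix.single i i a = Matrix.scalar ι a * Matrix.single i i (1 : A) := by
    ext j k
    simp [Matrix.single_apply, Matrix.scalar_apply]
  rw [h2]
  refine (cstarNorm_mul_le _ _).trans ?_
  exact (mul_le_of_le_one_right (Real.sqrt_nonneg _) h1).trans (cstarNorm_scalar_le a)

lemma cstarNorm_col_sq (i : ι) (a : ι → A) :
    cstarNorm (Matrix.of fun k l => if l = i then a k else 0 : Matrix ι ι A) ^ 2 =
      ‖∑ k, star (a k) * a k‖ := by
  rw [← cstarNorm_star_mul_self, ← cstarNorm_single i]
  congr 1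
  ext k l
  rw [mul_apply, single_apply]
  by_cases hk : k = i <;> by_cases hl : l = i <;>
    simp [Matrix.star_apply, hk, hl, eq_comm (a := i)]

lemma cstarNorm_row_sq (i : ι) (a : ι → A) :
    cstarNorm (Matrix.of fun k l => if k = i then a l else 0 : Matrix ι ι A) ^ 2 =
      ‖∑ k, a k * star (a k)‖ := by
  have h := cstarNorm_col_sq i (fun k => star (a k))
  simp only [star_star] at h
  rw [← h, ← cstarNorm_star]
  congr 2
  ext k l
  simp [Matrix.star_apply, apply_ite star]

end Matrix

end MatrixNorm

/-! ### Completely bounded norms -/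

section CompletelyBounded

variable {A B : Type*} [CStarAlgebra A] [CStarAlgebra B]

lemma CStarAlgebra.norm_algebraMap_le (z : ℂ) : ‖algebraMap ℂ A z‖ ≤ ‖z‖ := by
  have h : ‖(1 : A)‖ * ‖(1 : A)‖ = ‖(1 : A)‖ := by
    rw [← CStarRing.norm_star_mul_self, star_one, one_mul]
  rw [norm_algebraMap]
  exact mul_le_of_le_one_right (norm_nonneg _) (by nlinarith [norm_nonneg (1 : A)])

lemma Matrix.cstarNorm_col_algebraMap_le {ι : Type*} [Fintype ι] [DecidableEq ι] (i : ι)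
    (ξ : EuclideanSpace ℂ ι) :
    cstarNorm (Matrix.of fun k l => if l = i then algebraMap ℂ A (ξ k) else 0 : Matrix ι ι A) ≤
      ‖ξ‖ := by
  refine le_of_pow_le_pow_left₀ two_ne_zero (norm_nonneg _) ?_
  rw [Matrix.cstarNorm_col_sq]
  simp_rw [← algebraMap_star_comm, ← map_mul, ← map_sum]
  refine (CStarAlgebra.norm_algebraMap_le _).trans ?_
  rw [EuclideanSpace.norm_sq_eq]
  refine (norm_sum_le _ _).trans_eq (Finset.sum_congr rfl fun k _ => ?_)
  rw [norm_mul, norm_star, sq]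

open scoped Matrix.Norms.L2Operator in
/-- Bounded functionals are completely bounded. -/
lemma norm_map_functional_le {E : Type*} [AddCommGroup E] [Module ℂ E] (j : E →ₗ[ℂ] A)
    (φ : E →ₗ[ℂ] ℂ) {c : ℝ} (hφ : ∀ e, ‖φ e‖ ≤ c * ‖j e‖) (hc : 0 ≤ c) {n : ℕ}
    (x : Matrix (Fin n) (Fin n) E) : ‖x.map φ‖ ≤ c * matNorm j x := by
  have hx0 : 0 ≤ matNorm j x := Real.sqrt_nonneg _
  rw [Matrix.cstar_norm_def]
  refine ContinuousLinearMap.opNorm_le_bound _ (by positivity) fun ξ => ?_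
  set η := Matrix.toEuclideanCLM (n := Fin n) (𝕜 := ℂ) (x.map φ) ξ with hη
  rcases isEmpty_or_nonempty (Fin n) with hn | ⟨⟨i⟩⟩
  · rw [Subsingleton.elim η 0, norm_zero]
    positivity
  let Ξ : Matrix (Fin n) (Fin n) A :=
    Matrix.of fun k l => if l = i then algebraMap ℂ A (ξ k) else 0
  let Η : Matrix (Fin n) (Fin n) A :=
    Matrix.of fun k l => if l = i then algebraMap ℂ A (η k) else 0
  have h1 : ((‖η‖ ^ 2 : ℝ) : ℂ) = φ (∑ k, ∑ l, (star (η k) * ξ l) • x k l) := by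
    simp only [map_sum, map_smul, smul_eq_mul, EuclideanSpace.norm_sq_eq]
    push_cast
    refine Finset.sum_congr rfl fun k _ => ?_
    rw [← Complex.conj_mul']
    conv_lhs => rhs; rw [hη, Matrix.ofLp_toEuclideanCLM]
    simp only [Matrix.mulVec, dotProduct, Finset.mul_sum, Matrix.map_apply]
    refine Finset.sum_congr rfl fun l _ => ?_
    rw [mul_comm (φ _), mul_assoc]
    rfl
  have h2 : j (∑ k, ∑ l, (star (η k) * ξ l) • x k l) = (star Η * x.map (fun e => j e) * Ξ) i i := by
    simp only [map_sum, map_smul, Matrix.mul_apply, Finset.sum_mul, Ξ, Η, Matrix.star_apply,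
      Matrix.of_apply, Matrix.map_apply, if_true]
    rw [Finset.sum_comm]
    refine Finset.sum_congr rfl fun l _ => Finset.sum_congr rfl fun k _ => ?_
    rw [← algebraMap_star_comm, mul_assoc, ← Algebra.commutes (ξ l), ← mul_assoc, ← map_mul,
      Algebra.smul_def]
  have h3 : ‖η‖ ^ 2 ≤ c * (‖η‖ * matNorm j x * ‖ξ‖) := by
    calc ‖η‖ ^ 2 = ‖((‖η‖ ^ 2 : ℝ) : ℂ)‖ := by
          rw [Complex.norm_real, Real.norm_of_nonneg (by positivity)]
      _ ≤ c * ‖(star Η * x.map (fun e => j e) * Ξ) i i‖ := by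
          rw [h1, ← h2]
          exact hφ _
      _ ≤ c * (cstarNorm (star Η) * cstarNorm (x.map fun e => j e) * cstarNorm Ξ) := by
          gcongr
          refine (Matrix.norm_apply_le_cstarNorm _ _ _).trans ?_
          refine (Matrix.cstarNorm_mul_le _ _).trans ?_
          exact mul_le_mul_of_nonneg_right (Matrix.cstarNorm_mul_le _ _) (Real.sqrt_nonneg _)
      _ ≤ c * (‖η‖ * matNorm j x * ‖ξ‖) := by
          rw [Matrix.cstarNorm_star]
          have hH := Matrix.cstarNorm_col_algebraMap_le (A := A) i η
          have hX := Matrix.cstarNorm_col_algebraMap_le (A := A) i ξ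
          have h0 : 0 ≤ cstarNorm Ξ := Real.sqrt_nonneg _
          exact mul_le_mul_of_nonneg_left (mul_le_mul (mul_le_mul_of_nonneg_right hH hx0) hX h0
            (by positivity)) hc
  rcases (norm_nonneg η).eq_or_lt with h0 | h0
  · rw [← h0]
    positivity
  · refine le_of_mul_le_mul_left ?_ h0
    rw [← sq]
    exact h3.trans_eq (by ring)

lemma matNorm_smul {E : Type*} [AddCommGroup E] [Module ℂ E] (j : E →ₗ[ℂ] A) {n : ℕ} (z : ℂ)
    (x : Matrix (Fin n) (Fin n) E) : matNorm j (z • x) = ‖z‖ * matNorm j x := by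
  rw [matNorm, matNorm, ← Matrix.cstarNorm_smul]
  congr 1
  ext k l
  simp

open scoped Matrix.Norms.L2Operator in
/-- Linear maps on finite-dimensional spaces are completely bounded. -/
lemma exists_matNorm_map_le {G : Submodule ℂ A} [FiniteDimensional ℂ G] {F : Submodule ℂ B}
    (w : G →ₗ[ℂ] F) : ∃ K : ℝ, ∀ (n : ℕ) (x : Matrix (Fin n) (Fin n) G),
      matNorm F.subtype (x.map fun e => w e) ≤ K * matNorm G.subtype x := by
  let b := Module.finBasis ℂ G
  let φ := fun r => LinearMap.toContinuousLinearMap (b.coord r)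
  refine ⟨∑ r, ‖φ r‖ * ‖(w (b r) : B)‖, fun n x => ?_⟩
  have h : ((x.map fun e => w e).map fun e => F.subtype e) =
      ∑ r, ((x.map (b.coord r)).map (algebraMap ℂ B)) * Matrix.scalar (Fin n) (w (b r) : B) := by
    ext k l
    rw [Matrix.sum_apply]
    have hb := congrArg (fun e => (w e : B)) (b.sum_repr (x k l))
    simp only [map_sum, map_smul, Submodule.coe_sum, Submodule.coe_smul, Algebra.smul_def] at hb
    simpa [Matrix.scalar_apply] using hb.symm
  rw [matNorm, h, Finset.sum_mul]
  refine (Matrix.cstarNorm_sum_le _ _).trans (Finset.sum_le_sum fun r _ => ?_)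
  have h1 := norm_map_functional_le G.subtype (b.coord r) (fun e => (φ r).le_opNorm e)
    (norm_nonneg _) x
  calc _ ≤ ‖x.map (b.coord r)‖ * ‖(w (b r) : B)‖ :=
        (Matrix.cstarNorm_mul_le _ _).trans (mul_le_mul (Matrix.cstarNorm_map_algebraMap_le _)
          (Matrix.cstarNorm_scalar_le _) (Real.sqrt_nonneg _) (norm_nonneg _))
    _ ≤ ‖φ r‖ * matNorm G.subtype x * ‖(w (b r) : B)‖ := by gcongr
    _ = _ := by ring

lemma matNorm_nonneg {E : Type*} [AddCommGroup E] [Module ℂ E] (j : E →ₗ[ℂ] A) {n : ℕ}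
    (x : Matrix (Fin n) (Fin n) E) : 0 ≤ matNorm j x := Real.sqrt_nonneg _

lemma cbNorm_nonneg {E F : Type*} [AddCommGroup E] [Module ℂ E] [AddCommGroup F] [Module ℂ F]
    (j : E →ₗ[ℂ] A) (k : F →ₗ[ℂ] B) (w : E →ₗ[ℂ] F) : 0 ≤ cbNorm j k w := by
  refine Real.sSup_nonneg ?_
  rintro _ ⟨n, x, -, rfl⟩
  exact matNorm_nonneg k _

/-- The completely bounded norm bounds all amplifications. -/
theorem matNorm_map_le_cbNorm {G : Submodule ℂ A} [FiniteDimensional ℂ G] {F : Submodule ℂ B}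
    (w : G →ₗ[ℂ] F) {n : ℕ} (x : Matrix (Fin n) (Fin n) G) :
    matNorm F.subtype (x.map fun e => w e) ≤
      cbNorm G.subtype F.subtype w * matNorm G.subtype x := by
  obtain ⟨K, hK⟩ := exists_matNorm_map_le w
  have hbdd : BddAbove (cbNormSet G.subtype F.subtype w) := by
    refine ⟨|K|, ?_⟩
    rintro _ ⟨m, z, hz, rfl⟩
    exact (hK m z).trans ((mul_le_mul_of_nonneg_right (le_abs_self K) (matNorm_nonneg _ _)).trans
      (mul_le_of_le_one_right (abs_nonneg K) hz))
  rcases (matNorm_nonneg G.subtype x).eq_or_lt with h0 | h0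
  · simpa [← h0] using hK n x
  · set t := matNorm G.subtype x with ht
    have hx : matNorm G.subtype (((t⁻¹ : ℝ) : ℂ) • x) = 1 := by
      rw [matNorm_smul, ← ht, Complex.norm_real, Real.norm_of_nonneg (by positivity),
        inv_mul_cancel₀ h0.ne']
    have h1 := le_csSup hbdd ⟨n, _, hx.le, rfl⟩
    have h2 : ((((t⁻¹ : ℝ) : ℂ) • x).map fun e => w e) =
        ((t⁻¹ : ℝ) : ℂ) • (x.map fun e => w e) := by
      ext k l
      simp
    rw [h2, matNorm_smul, Complex.norm_real, Real.norm_of_nonneg (by positivity),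
      inv_mul_le_iff₀ h0, mul_comm] at h1
    exact h1

/-- Completely bounded maps are bounded for row and column norms. -/
theorem norm_sum_star_mul_map_le {G : Submodule ℂ A} [FiniteDimensional ℂ G] {F : Submodule ℂ B}
    (w : G →ₗ[ℂ] F) {m : ℕ} (x : Fin (m + 1) → G) :
    ‖∑ k, star (w (x k) : B) * (w (x k) : B)‖ ≤
      cbNorm G.subtype F.subtype w ^ 2 * ‖∑ k, star (x k : A) * (x k : A)‖ := by
  have h := matNorm_map_le_cbNorm w (Matrix.of fun k l : Fin (m + 1) => if l = 0 then x k else 0)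
  have h1 := pow_le_pow_left₀ (matNorm_nonneg _ _) h 2
  have hG : ((Matrix.of fun k l : Fin (m + 1) => if l = 0 then x k else 0).map fun e =>
      G.subtype e) = Matrix.of fun k l => if l = 0 then (x k : A) else 0 := by
    ext k l
    by_cases h0 : l = 0 <;> simp [h0]
  have hF : (((Matrix.of fun k l : Fin (m + 1) => if l = 0 then x k else 0).map fun e => w e).map
      fun e => F.subtype e) = Matrix.of fun k l => if l = 0 then (w (x k) : B) else 0 := by
    ext k l
    by_cases h0 : l = 0 <;> simp [h0]
  rwa [mul_pow, matNorm, matNorm, hG, hF, Matrix.cstarNorm_col_sq, Matrix.cstarNorm_col_sq] at h1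

theorem norm_sum_mul_star_map_le {G : Submodule ℂ A} [FiniteDimensional ℂ G] {F : Submodule ℂ B}
    (w : G →ₗ[ℂ] F) {m : ℕ} (x : Fin (m + 1) → G) :
    ‖∑ k, (w (x k) : B) * star (w (x k) : B)‖ ≤
      cbNorm G.subtype F.subtype w ^ 2 * ‖∑ k, (x k : A) * star (x k : A)‖ := by
  have h := matNorm_map_le_cbNorm w (Matrix.of fun k l : Fin (m + 1) => if k = 0 then x l else 0)
  have h1 := pow_le_pow_left₀ (matNorm_nonneg _ _) h 2
  have hG : ((Matrix.of fun k l : Fin (m + 1) => if k = 0 then x l else 0).map fun e =>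
      G.subtype e) = Matrix.of fun k l => if k = 0 then (x l : A) else 0 := by
    ext k l
    by_cases h0 : k = 0 <;> simp [h0]
  have hF : (((Matrix.of fun k l : Fin (m + 1) => if k = 0 then x l else 0).map fun e => w e).map
      fun e => F.subtype e) = Matrix.of fun k l => if k = 0 then (w (x l) : B) else 0 := by
    ext k l
    by_cases h0 : k = 0 <;> simp [h0]
  rwa [mul_pow, matNorm, matNorm, hG, hF, Matrix.cstarNorm_row_sq, Matrix.cstarNorm_row_sq] at h1

end CompletelyBounded

/-! ### The summing estimate -/

section Summing

/-- A finite-dimensional space embeds into diagonal matrices. -/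
lemma dSKfin_set_nonempty {A : Type*} [CStarAlgebra A] (G : Submodule ℂ A)
    [FiniteDimensional ℂ G] :
    {c | ∃ (N : ℕ) (Fm : Submodule ℂ (Matrix (Fin N) (Fin N) ℂ)) (v : ↥G ≃ₗ[ℂ] ↥Fm),
      c = cbNorm G.subtype Fm.subtype v.toLinearMap *
        cbNorm Fm.subtype G.subtype v.symm.toLinearMap}.Nonempty := by
  let f := Matrix.diagonalLinearMap (Fin (Module.finrank ℂ G)) ℂ ℂ ∘ₗ
    (Module.finBasis ℂ G).equivFun.toLinearMap
  have hf : Function.Injective f :=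
    Matrix.diagonal_injective.comp (Module.finBasis ℂ G).equivFun.injective
  exact ⟨_, _, _, LinearEquiv.ofInjective f hf, rfl⟩

open scoped Matrix.Norms.L2Operator in
theorem sqrt_sum_norm_sq_le_of_linearEquiv {A H : Type*} [CStarAlgebra A]
    [NormedAddCommGroup H] [NormedSpace ℂ H] {G : Submodule ℂ A} [FiniteDimensional ℂ G]
    {v : G →ₗ[ℂ] H} {C : ℝ} (hC : 0 ≤ C)
    (hv : ∀ (n : ℕ) (x : Matrix (Fin n) (Fin n) G),
      Real.sqrt ((n : ℝ)⁻¹ * ∑ i, ∑ j, ‖v (x i j)‖ ^ 2) ≤ C * matNorm G.subtype x)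
    {N : ℕ} {F : Submodule ℂ (Matrix (Fin N) (Fin N) ℂ)} (w : G ≃ₗ[ℂ] F)
    {m : ℕ} (x : Fin (m + 1) → G) :
    Real.sqrt (∑ k, ‖v (x k)‖ ^ 2) ≤
      2 * C * (cbNorm G.subtype F.subtype w.toLinearMap *
        cbNorm F.subtype G.subtype w.symm.toLinearMap) *
      Real.sqrt (max ‖∑ k, (x k : A) * star (x k : A)‖ ‖∑ k, star (x k : A) * (x k : A)‖) := by
  set a := cbNorm G.subtype F.subtype w.toLinearMap
  set b := cbNorm F.subtype G.subtype w.symm.toLinearMap with hb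
  set R := max ‖∑ k, (x k : A) * star (x k : A)‖ ‖∑ k, star (x k : A) * (x k : A)‖
  have ha0 : 0 ≤ a :=
    cbNorm_nonneg (B := Matrix (Fin N) (Fin N) ℂ) G.subtype F.subtype w.toLinearMap
  have hb0 : 0 ≤ b :=
    cbNorm_nonneg (A := Matrix (Fin N) (Fin N) ℂ) F.subtype G.subtype w.symm.toLinearMap
  have hR0 : 0 ≤ R := le_max_of_le_left (norm_nonneg _)
  have key : ∀ ε : ℝ, 0 < ε → Real.sqrt (∑ k, ‖v (x k)‖ ^ 2) ≤
      C * (b * Real.sqrt (4 * (a ^ 2 * R + ε) * (1 + ε))) +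
        (∑ k, ‖v (x k)‖) * Real.sqrt ε := by
    intro ε hε
    have hcol : ‖∑ k, star (w (x k) : Matrix (Fin N) (Fin N) ℂ) * (w (x k) : Matrix _ _ ℂ)‖ ≤
        a ^ 2 * R + ε := by
      have h := norm_sum_star_mul_map_le (B := Matrix (Fin N) (Fin N) ℂ) w.toLinearMap x
      exact (h.trans (mul_le_mul_of_nonneg_left (le_max_right _ _) (sq_nonneg a))).trans
        (le_add_of_nonneg_right hε.le)
    have hrow : ‖∑ k, (w (x k) : Matrix (Fin N) (Fin N) ℂ) * star (w (x k) : Matrix _ _ ℂ)‖ ≤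
        a ^ 2 * R + ε := by
      have h := norm_sum_mul_star_map_le (B := Matrix (Fin N) (Fin N) ℂ) w.toLinearMap x
      exact (h.trans (mul_le_mul_of_nonneg_left (le_max_left _ _) (sq_nonneg a))).trans
        (le_add_of_nonneg_right hε.le)
    obtain ⟨n, hn, σ, h, hσ, hh, hle⟩ := exists_perm_projection_cstarNorm_le
      (fun k => (w (x k) : Matrix (Fin N) (Fin N) ℂ)) (by positivity) hε hε hcol hrow
    have : Nonempty (Fin n) := ⟨⟨0, hn⟩⟩
    let Y : Matrix (Fin n) (Fin n) F := Matrix.of fun i j => ∑ k, h ((σ k).symm i) j • w (x k)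
    have hY : matNorm F.subtype Y ≤ Real.sqrt (4 * (a ^ 2 * R + ε) * (1 + ε)) := by
      refine Real.le_sqrt_of_sq_le (le_of_eq_of_le ?_ hle)
      refine congrArg (fun M => cstarNorm M ^ 2) ?_
      ext1 i j
      simp [Y]
    have hZ := matNorm_map_le_cbNorm (A := Matrix (Fin N) (Fin N) ℂ) w.symm.toLinearMap Y
    have hYZ : (Y.map fun e => w.symm.toLinearMap e) =
        Matrix.of fun i j => ∑ k, h ((σ k).symm i) j • x k := by
      ext1 i j
      simp [Y]
    rw [hYZ, ← hb] at hZ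
    have h2 := sqrt_sum_norm_sq_le_of_perm v x σ hσ h hε.le (by simpa using hh)
    refine h2.trans (add_le_add_left ?_ _)
    rw [Fintype.card_fin]
    refine (hv n _).trans (mul_le_mul_of_nonneg_left ?_ hC)
    exact hZ.trans (mul_le_mul_of_nonneg_left hY hb0)
  have hlim : Filter.Tendsto (fun ε : ℝ => C * (b * Real.sqrt (4 * (a ^ 2 * R + ε) * (1 + ε))) +
        (∑ k, ‖v (x k)‖) * Real.sqrt ε) (nhdsWithin 0 (Set.Ioi 0))
      (nhds (2 * C * (a * b) * Real.sqrt R)) := by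
    have hc : Continuous (fun ε : ℝ => C * (b * Real.sqrt (4 * (a ^ 2 * R + ε) * (1 + ε))) +
        (∑ k, ‖v (x k)‖) * Real.sqrt ε) := by fun_prop
    refine (hc.tendsto' 0 _ ?_).mono_left nhdsWithin_le_nhds
    have h4 : 4 * (a ^ 2 * R + 0) * (1 + 0) = (2 * a) ^ 2 * R := by ring
    rw [Real.sqrt_zero, h4, Real.sqrt_mul (sq_nonneg _), Real.sqrt_sq (by positivity)]
    ring
  exact ge_of_tendsto hlim (eventually_mem_nhdsWithin.mono key)

theorem sqrt_sum_norm_sq_le_dSKfin {A H : Type*} [CStarAlgebra A]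
    [NormedAddCommGroup H] [NormedSpace ℂ H] {G : Submodule ℂ A} [FiniteDimensional ℂ G]
    {v : G →ₗ[ℂ] H} {C : ℝ} (hC : 0 ≤ C)
    (hv : ∀ (n : ℕ) (x : Matrix (Fin n) (Fin n) G),
      Real.sqrt ((n : ℝ)⁻¹ * ∑ i, ∑ j, ‖v (x i j)‖ ^ 2) ≤ C * matNorm G.subtype x)
    {m : ℕ} (x : Fin (m + 1) → G) :
    Real.sqrt (∑ k, ‖v (x k)‖ ^ 2) ≤ 2 * C * dSKfin G *
      Real.sqrt (max ‖∑ k, (x k : A) * star (x k : A)‖ ‖∑ k, star (x k : A) * (x k : A)‖) := by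
  set R := max ‖∑ k, (x k : A) * star (x k : A)‖ ‖∑ k, star (x k : A) * (x k : A)‖
  have hmono : Continuous fun t : ℝ => 2 * C * t * Real.sqrt R := by fun_prop
  refine ge_of_tendsto (hmono.tendsto' (dSKfin G) _ rfl |>.mono_left
    (nhdsWithin_le_nhds (s := Set.Ioi (dSKfin G)))) (eventually_mem_nhdsWithin.mono fun t ht => ?_)
  obtain ⟨_, ⟨N, F, w, rfl⟩, hw⟩ := exists_lt_of_csInf_lt (dSKfin_set_nonempty G) ht
  refine (sqrt_sum_norm_sq_le_of_linearEquiv hC hv w x).trans ?_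
  gcongr

end Summing

/-- **(2,RC)-summingness from a tracial ℓ₂-bound** (Corollary 1.9 in Junge–Pisier).  Let
`E ⊆ A` be an exact closed subspace of a C*-algebra, `H` a Hilbert space, `v : E → H`
linear and `C > 0`.  If for every `n` and every `(x_{ij}) ∈ Mₙ(E)` one has
`((1/n) ∑_{ij} ‖v x_{ij}‖²)^{1/2} ≤ C ‖(x_{ij})‖_{Mₙ(E)}`, then `v` is `(2,RC)`-summing
with `π_{2,RC}(v) ≤ 2 C d_SK(E)`. -/
theorem rc_summing_of_tracial_bound {A H : Type*} [CStarAlgebra A]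
    [NormedAddCommGroup H] [InnerProductSpace ℂ H] [CompleteSpace H]
    (E : Submodule ℂ A) (hE : IsClosed (E : Set A)) (hEex : IsExactSubspace E)
    (v : ↥E →ₗ[ℂ] H) (C : ℝ) (hC : 0 < C)
    (hv : ∀ (n : ℕ) (x : Matrix (Fin n) (Fin n) ↥E),
      Real.sqrt ((n : ℝ)⁻¹ * ∑ i, ∑ j, ‖v (x i j)‖ ^ 2) ≤ C * matNorm E.subtype x) :
    RCBound E.subtype v (2 * C * dSK E) := by
  intro m x
  rcases m with _ | m
  · simp
  let G := Submodule.span ℂ (Set.range fun k => (x k : A))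
  have hGE : G ≤ E := Submodule.span_le.mpr (Set.range_subset_iff.mpr fun k => (x k).2)
  have : FiniteDimensional ℂ G := FiniteDimensional.span_of_finite ℂ (Set.finite_range _)
  have h := sqrt_sum_norm_sq_le_dSKfin (v := v ∘ₗ Submodule.inclusion hGE) hC.le
    (fun n z => hv n (z.map (Submodule.inclusion hGE)))
    (fun k => ⟨(x k : A), Submodule.subset_span (Set.mem_range_self k)⟩)
  have hd : dSKfin G ≤ dSK E := le_csSup hEex ⟨G, hGE, this, rfl⟩
  have h2 : Real.sqrt (∑ k, ‖v (x k)‖ ^ 2) ≤ 2 * C * dSK E *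
      Real.sqrt (max ‖∑ k, (x k : A) * star (x k : A)‖ ‖∑ k, star (x k : A) * (x k : A)‖) :=
    h.trans (by gcongr)
  have h3 := pow_le_pow_left₀ (Real.sqrt_nonneg _) h2 2
  rwa [mul_pow, Real.sq_sqrt (by positivity),
    Real.sq_sqrt (le_max_of_le_left (norm_nonneg _))] at h3

end
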